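/- Bellman local optimality equation is necessary for global optimality: assume π^{d}(i) > 0 for every deterministic policy d and every state i. Let d* be a deterministic policy with CVaR^{d*} ≤ CVaR^{d} for all deterministic policies d, let y* := VaR^{d*}, and let g be a solution of the Poisson equation for d* at y*. Then for every i ∈ S and every a ∈ A, c̃(y*,i,d*(i)) + Σ_{j∈S} p(j|i,d*(i))·g(j) ≤ c̃(y*,i,a) + Σ_{j∈S} p(j|i,a)·g(j); equivalently, g(i) + CVaR^{d*} = min_{a∈A} { c̃(y*,i,a) + Σ_{j∈S} p(j|i,a)·g(j) } for every i ∈ S. -/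

import Mathlib

/-- The pseudo-CVaR cost `c̃(y,i,a) = y + (1-α)⁻¹ max(c(i,a) - y, 0)`. -/
noncomputable def ctil {S A : Type*} (α : ℝ) (c : S → A → ℝ) (y : ℝ) (i : S) (a : A) : ℝ :=
  y + (1 - α)⁻¹ * max (c i a - y) 0

/-- The pseudo CVaR `ṼC^d(y) = Σ_i π(i) c̃(y,i,d(i))` of a deterministic policy `d`
with stationary distribution `π`. -/
noncomputable def pC {S A : Type*} [Fintype S] (α : ℝ) (c : S → A → ℝ) (π : S → ℝ)
    (d : S → A) (y : ℝ) : ℝ :=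
  ∑ i, π i * ctil α c y i (d i)

/-- The long-run CVaR `CVaR^d = inf_{y ∈ ℝ} ṼC^d(y)`. -/
noncomputable def CV {S A : Type*} [Fintype S] (α : ℝ) (c : S → A → ℝ) (π : S → ℝ)
    (d : S → A) : ℝ :=
  sInf (Set.range (pC α c π d))

/-- The long-run VaR `VaR^d = inf {w : Σ_{i : c(i,d(i)) ≤ w} π(i) ≥ α}`. -/
noncomputable def VaR {S A : Type*} [Fintype S] (α : ℝ) (c : S → A → ℝ) (π : S → ℝ)
    (d : S → A) : ℝ :=
  sInf {w : ℝ | α ≤ ∑ i, if c i (d i) ≤ w then π i else 0}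

open Filter Topology

lemma bddBelow_VaR_set {S A : Type*} [Fintype S] {α : ℝ} (hα0 : 0 < α)
    (c : S → A → ℝ) (π : S → ℝ) (d : S → A) :
    BddBelow {w : ℝ | α ≤ ∑ i, if c i (d i) ≤ w then π i else 0} := by
  obtain ⟨m, hm⟩ := (Set.finite_range fun i => c i (d i)).bddBelow
  refine ⟨m, fun v hv => ?_⟩
  by_contra! hlt
  have : ∀ i, ¬ c i (d i) ≤ v := fun i => not_le.2 (hlt.trans_le (hm ⟨i, rfl⟩))
  simp only [Set.mem_ofPred_eq, this, if_false, Finset.sum_const_zero] at hv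
  linarith

/-- The distribution function of the cost reaches the level `α` at the VaR. -/
lemma le_sum_VaR {S A : Type*} [Fintype S] {α : ℝ} (hα0 : 0 < α) (hα1 : α < 1)
    (c : S → A → ℝ) (π : S → ℝ) (hπ1 : ∑ i, π i = 1) (d : S → A) :
    α ≤ ∑ i, if c i (d i) ≤ VaR α c π d then π i else 0 := by
  set y := VaR α c π d
  have hgap : ∀ᶠ w in 𝓝[>] y, ∀ i, y < c i (d i) → w < c i (d i) := by
    refine eventually_all.2 fun i => ?_
    by_cases h : y < c i (d i)
    · filter_upwards [Ioo_mem_nhdsGT h] with w hw _ using hw.2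
    · exact Eventually.of_forall fun w h' => absurd h' h
  obtain ⟨w, hw, hyw⟩ := (hgap.and self_mem_nhdsWithin).exists
  have hne : {w : ℝ | α ≤ ∑ i, if c i (d i) ≤ w then π i else 0}.Nonempty := by
    obtain ⟨M, hM⟩ := (Set.finite_range fun i => c i (d i)).bddAbove
    refine ⟨M, ?_⟩
    have : ∀ i, c i (d i) ≤ M := fun i => hM ⟨i, rfl⟩
    simp [this, hπ1, hα1.le]
  have hbdd := bddBelow_VaR_set hα0 c π d
  obtain ⟨v, hv, hvw⟩ := exists_lt_of_csInf_lt hne (show sInf _ < w from hyw)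
  have hyv : y ≤ v := csInf_le hbdd hv
  refine (show α ≤ _ from hv).trans (le_of_eq (Finset.sum_congr rfl fun i _ => ?_))
  have : c i (d i) ≤ v ↔ c i (d i) ≤ y := by
    refine ⟨fun h => ?_, fun h => h.trans hyv⟩
    by_contra! h'
    linarith [hw i h']
  simp [this]

/-- The probability of a cost strictly below the VaR is at most `α`. -/
lemma sum_lt_VaR_le {S A : Type*} [Fintype S] {α : ℝ} (hα0 : 0 < α)
    (c : S → A → ℝ) (π : S → ℝ) (d : S → A) :
    (∑ i, if c i (d i) < VaR α c π d then π i else 0) ≤ α := by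
  set y := VaR α c π d
  have hgap : ∀ᶠ w in 𝓝[<] y, ∀ i, c i (d i) < y → c i (d i) < w := by
    refine eventually_all.2 fun i => ?_
    by_cases h : c i (d i) < y
    · filter_upwards [Ioo_mem_nhdsLT h] with w hw _ using hw.1
    · exact Eventually.of_forall fun w h' => absurd h' h
  obtain ⟨w, hw, hwy⟩ := (hgap.and self_mem_nhdsWithin).exists
  have hwy : w < y := hwy
  have hbdd := bddBelow_VaR_set hα0 c π d
  have hmem : (∑ i, if c i (d i) ≤ w then π i else 0) < α :=
    not_le.1 fun h => hwy.not_ge (csInf_le hbdd h)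
  refine (le_of_eq (Finset.sum_congr rfl fun i _ => ?_)).trans hmem.le
  have : c i (d i) < y ↔ c i (d i) ≤ w := ⟨fun h => (hw i h).le, fun h => h.trans_lt hwy⟩
  simp [this]

lemma pC_eq {S A : Type*} [Fintype S] (α : ℝ) (c : S → A → ℝ) (π : S → ℝ)
    (hπ1 : ∑ i, π i = 1) (d : S → A) (y : ℝ) :
    pC α c π d y = y + (1 - α)⁻¹ * ∑ i, π i * max (c i (d i) - y) 0 := by
  simp only [pC, ctil, mul_add, Finset.sum_add_distrib, ← Finset.sum_mul, hπ1, one_mul,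
    Finset.mul_sum]
  congr 1
  exact Finset.sum_congr rfl fun i _ => by ring

/-- The VaR minimizes the pseudo CVaR. -/
lemma pC_VaR_le {S A : Type*} [Fintype S] {α : ℝ} (hα0 : 0 < α) (hα1 : α < 1)
    (c : S → A → ℝ) (π : S → ℝ) (hπ0 : ∀ i, 0 ≤ π i) (hπ1 : ∑ i, π i = 1) (d : S → A) (z : ℝ) :
    pC α c π d (VaR α c π d) ≤ pC α c π d z := by
  have h1 := le_sum_VaR hα0 hα1 c π hπ1 d
  have h2 := sum_lt_VaR_le hα0 c π d
  rw [pC_eq α c π hπ1, pC_eq α c π hπ1]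
  set y := VaR α c π d
  have hpos : 0 < 1 - α := by linarith
  suffices h : (1 - α) * (y - z) ≤
      (∑ i, π i * max (c i (d i) - z) 0) - ∑ i, π i * max (c i (d i) - y) 0 by
    have := mul_le_mul_of_nonneg_left h (inv_pos.2 hpos).le
    rw [inv_mul_cancel_left₀ hpos.ne', mul_sub] at this
    linarith
  rcases le_total y z with hyz | hyz
  · have key : (∑ i, (π i - if c i (d i) ≤ y then π i else 0) * (y - z)) ≤
        ∑ i, (π i * max (c i (d i) - z) 0 - π i * max (c i (d i) - y) 0) := by
      refine Finset.sum_le_sum fun i _ => ?_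
      rw [← mul_sub]
      split_ifs with h
      · rw [max_eq_right (by linarith), max_eq_right (by linarith)]; simp
      · rw [sub_zero, max_eq_left (by linarith : 0 ≤ c i (d i) - y)]
        exact mul_le_mul_of_nonneg_left (by linarith [le_max_left (c i (d i) - z) 0]) (hπ0 i)
    rw [← Finset.sum_mul, Finset.sum_sub_distrib, Finset.sum_sub_distrib, hπ1] at key
    nlinarith
  · have key : (∑ i, (π i - if c i (d i) < y then π i else 0) * (y - z)) ≤
        ∑ i, (π i * max (c i (d i) - z) 0 - π i * max (c i (d i) - y) 0) := by
      refine Finset.sum_le_sum fun i _ => ?_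
      rw [← mul_sub]
      split_ifs with h
      · rw [sub_self, zero_mul, max_eq_right (by linarith : c i (d i) - y ≤ 0), sub_zero]
        exact mul_nonneg (hπ0 i) (le_max_right _ _)
      · rw [sub_zero, max_eq_left (by linarith : 0 ≤ c i (d i) - y)]
        exact mul_le_mul_of_nonneg_left (by linarith [le_max_left (c i (d i) - z) 0]) (hπ0 i)
    rw [← Finset.sum_mul, Finset.sum_sub_distrib, Finset.sum_sub_distrib, hπ1] at key
    nlinarith

/-- The long-run CVaR is the pseudo CVaR at the VaR, a minimum over all levels. -/
lemma isLeast_pC_VaR {S A : Type*} [Fintype S] {α : ℝ} (hα0 : 0 < α) (hα1 : α < 1)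
    (c : S → A → ℝ) (π : S → ℝ) (hπ0 : ∀ i, 0 ≤ π i) (hπ1 : ∑ i, π i = 1) (d : S → A) :
    IsLeast (Set.range (pC α c π d)) (pC α c π d (VaR α c π d)) :=
  ⟨⟨_, rfl⟩, Set.forall_mem_range.2 (pC_VaR_le hα0 hα1 c π hπ0 hπ1 d)⟩

/-- The drift `P g - g` of any function `g` averages to zero under a stationary distribution
of `P`. -/
lemma sum_stationary_drift {S : Type*} [Fintype S] (π : S → ℝ) (P : S → S → ℝ)
    (hπ : ∀ j, ∑ i, π i * P i j = π j) (g : S → ℝ) :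
    ∑ i, π i * ((∑ j, P i j * g j) - g i) = 0 := by
  have h : ∑ i, π i * ∑ j, P i j * g j = ∑ j, π j * g j := by
    simp only [Finset.mul_sum]
    rw [Finset.sum_comm]
    refine Finset.sum_congr rfl fun j _ => ?_
    rw [← hπ j, Finset.sum_mul]
    exact Finset.sum_congr rfl fun i _ => by ring
  simp only [mul_sub, Finset.sum_sub_distrib, h, sub_self]

/-- The Bellman local optimality equation is necessary for global
optimality of a deterministic policy for the long-run CVaR. -/
theorem bellman_local_optimality_necessary
    {S A : Type*} [Fintype S] [Fintype A] [Nonempty S] [Nonempty A]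
    (p : S → A → S → ℝ) (hp0 : ∀ i a j, 0 ≤ p i a j) (hp1 : ∀ i a, ∑ j, p i a j = 1)
    (c : S → A → ℝ) (α : ℝ) (hα : α ∈ Set.Ioo (0 : ℝ) 1)
    (sd : (S → A) → S → ℝ)
    (hsd0 : ∀ d i, 0 < sd d i) (hsd1 : ∀ d, ∑ i, sd d i = 1)
    (hsdstat : ∀ (d : S → A) (j : S), ∑ i, sd d i * p i (d i) j = sd d j)
    (dstar : S → A) (hopt : ∀ d : S → A, CV α c (sd dstar) dstar ≤ CV α c (sd d) d)
    (ystar : ℝ) (hy : ystar = VaR α c (sd dstar) dstar)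
    (g : S → ℝ)
    (hg : ∀ i, g i = ctil α c ystar i (dstar i) - pC α c (sd dstar) dstar ystar +
      ∑ j, p i (dstar i) j * g j) :
    (∀ (i : S) (a : A),
      ctil α c ystar i (dstar i) + (∑ j, p i (dstar i) j * g j) ≤
        ctil α c ystar i a + ∑ j, p i a j * g j) ∧
    (∀ i : S, g i + CV α c (sd dstar) dstar =
      ⨅ a : A, (ctil α c ystar i a + ∑ j, p i a j * g j)) := by
  classical
  obtain ⟨hα0, hα1⟩ := hα
  have hleast := fun d => isLeast_pC_VaR hα0 hα1 c (sd d) (fun i => (hsd0 d i).le) (hsd1 d) d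
  have hCV : CV α c (sd dstar) dstar = pC α c (sd dstar) dstar ystar :=
    hy ▸ (hleast dstar).csInf_eq
  have hmin : ∀ (i : S) (a : A),
      ctil α c ystar i (dstar i) + (∑ j, p i (dstar i) j * g j) ≤
        ctil α c ystar i a + ∑ j, p i a j * g j := by
    intro i a
    by_contra! hlt
    set d := Function.update dstar i a with hd
    have hle : pC α c (sd dstar) dstar ystar ≤ pC α c (sd d) d ystar :=
      hCV ▸ (hopt d).trans (csInf_le ⟨_, (hleast d).2⟩ ⟨_, rfl⟩)
    have hdrift := sum_stationary_drift (sd d) (fun k => p k (d k)) (hsdstat d) g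
    have hneg : ∑ k, sd d k * (ctil α c ystar k (d k) + (∑ j, p k (d k) j * g j) - g k
        - pC α c (sd dstar) dstar ystar) < 0 := by
      refine Finset.sum_neg' (fun k _ => ?_) ⟨i, Finset.mem_univ i, ?_⟩
      · refine mul_nonpos_of_nonneg_of_nonpos (hsd0 d k).le ?_
        rcases eq_or_ne k i with rfl | hk
        · rw [hd, Function.update_self]
          linarith [hg k]
        · rw [hd, Function.update_of_ne hk]
          linarith [hg k]
      · refine mul_neg_of_pos_of_neg (hsd0 d i) ?_
        rw [hd, Function.update_self]
        linarith [hg i]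
    have hsum : ∑ k, sd d k * (ctil α c ystar k (d k) + (∑ j, p k (d k) j * g j) - g k
        - pC α c (sd dstar) dstar ystar) =
        pC α c (sd d) d ystar + ∑ k, sd d k * ((∑ j, p k (d k) j * g j) - g k)
          - (∑ k, sd d k) * pC α c (sd dstar) dstar ystar := by
      rw [show pC α c (sd d) d ystar = ∑ k, sd d k * ctil α c ystar k (d k) from rfl,
        Finset.sum_mul, ← Finset.sum_add_distrib, ← Finset.sum_sub_distrib]
      exact Finset.sum_congr rfl fun k _ => by ring
    rw [hsum, hdrift, hsd1] at hneg
    linarith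
  refine ⟨hmin, fun i => ?_⟩
  have hgi : g i + CV α c (sd dstar) dstar =
      ctil α c ystar i (dstar i) + ∑ j, p i (dstar i) j * g j := by
    rw [hCV]
    linarith [hg i]
  rw [hgi]
  exact le_antisymm (le_ciInf (hmin i)) (ciInf_le (Set.finite_range _).bddBelow (dstar i))
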